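/- For 0 ≤ q ≤ 3, the series Î_q(t) = Σ_{d≥0} c_{d,q}·e^{dt} converges absolutely for each t ∈ H and defines a holomorphic function on H; setting I_{0,q}(t) = Σ_{k=0}^{q} (t^k/k!)·Î_{q−k}(t), each I_{0,q} satisfies the Picard–Fuchs equation D⁴f − 729·e^t·((D + 1/3)∘(D + 1/3)∘(D + 2/3)∘(D + 2/3))f = 0 on H (where D = d/dt and (D + c)f = f′ + c·f), and the four functions I_{0,0}, I_{0,1}, I_{0,2}, I_{0,3} are linearly independent over ℂ. -/

import Mathlib

/-- `a_d(w) = (∏_{r=1}^{3d} (3w+r)²) / (∏_{r=1}^{d} (w+r)⁶)`. -/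
noncomputable def aFun (d : ℕ) (w : ℂ) : ℂ :=
  (∏ r ∈ Finset.Icc 1 (3 * d), (3 * w + (r : ℂ)) ^ 2) /
    (∏ r ∈ Finset.Icc 1 d, (w + (r : ℂ)) ^ 6)

/-- `H = {t ∈ ℂ : Re t < −6·log 3}`, so that `729·|e^t| < 1` on `H`. -/
def Hset : Set ℂ := {t : ℂ | t.re < -6 * Real.log 3}

/-- `c_{d,q} = (1/q!)·(d/dw)^q a_d(w)|_{w=0}`, the `q`-th Taylor coefficient of `a_d` at `0`. -/
noncomputable def cCoef (d q : ℕ) : ℂ :=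
  iteratedDeriv q (aFun d) 0 / (q.factorial : ℂ)

/-- `Î_q(t) = Σ_{d≥0} c_{d,q}·e^{dt}`. -/
noncomputable def Ihat (q : ℕ) (t : ℂ) : ℂ :=
  ∑' d : ℕ, cCoef d q * Complex.exp (d * t)

/-- `I_{0,q}(t) = Σ_{k=0}^{q} (t^k/k!)·Î_{q−k}(t)`. -/
noncomputable def I0 (q : ℕ) (t : ℂ) : ℂ :=
  ∑ k ∈ Finset.range (q + 1), t ^ k / (k.factorial : ℂ) * Ihat (q - k) t

/-- The operator `(D + c)f = f′ + c·f`, where `D = d/dt`. -/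
noncomputable def DOp (c : ℂ) (f : ℂ → ℂ) : ℂ → ℂ :=
  fun t => deriv f t + c * f t

theorem aFun_zero (w : ℂ) : aFun 0 w = 1 := by simp [aFun]

theorem aFun_succ_mul (d : ℕ) {w : ℂ} (hw : w + ((d : ℂ) + 1) ≠ 0) :
    (w + ((d : ℂ) + 1)) ^ 4 * aFun (d + 1) w =
      729 * (w + ((d : ℂ) + 1 / 3)) ^ 2 * (w + ((d : ℂ) + 2 / 3)) ^ 2 * aFun d w := by
  have h : aFun (d + 1) w = aFun d w *
      (((3 * w + (3 * d + 1)) ^ 2 * (3 * w + (3 * d + 2)) ^ 2 * (3 * w + (3 * d + 3)) ^ 2) /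
        (w + ((d : ℂ) + 1)) ^ 6) := by
    unfold aFun
    rw [show 3 * (d + 1) = 3 * d + 1 + 1 + 1 by ring, Finset.prod_Icc_succ_top (by omega),
      Finset.prod_Icc_succ_top (by omega), Finset.prod_Icc_succ_top (by omega),
      Finset.prod_Icc_succ_top (by omega), div_mul_div_comm]
    push_cast
    congr 1
    ring
  rw [h]
  field_simp
  ring

theorem add_natCast_ne_zero_of_norm_lt_one {w : ℂ} (hw : ‖w‖ < 1) {r : ℕ} (hr : 1 ≤ r) :
    w + (r : ℂ) ≠ 0 := by
  intro h
  have h1 : ‖w‖ = r := by rw [eq_neg_of_add_eq_zero_left h]; simp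
  have h2 : (1 : ℝ) ≤ r := by exact_mod_cast hr
  linarith

theorem differentiableOn_aFun (d : ℕ) : DifferentiableOn ℂ (aFun d) (Metric.ball 0 1) := by
  unfold aFun
  refine DifferentiableOn.div (by fun_prop) (by fun_prop) fun w hw => ?_
  refine Finset.prod_ne_zero_iff.mpr fun r hr => pow_ne_zero _ ?_
  exact add_natCast_ne_zero_of_norm_lt_one (by simpa using hw) (Finset.mem_Icc.mp hr).1

theorem analyticAt_aFun (d : ℕ) : AnalyticAt ℂ (aFun d) 0 :=
  (differentiableOn_aFun d).analyticAt (Metric.ball_mem_nhds 0 one_pos)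

theorem norm_aFun_le (d : ℕ) {w : ℂ} (hw : ‖w‖ ≤ 1 / 4) :
    ‖aFun d w‖ ≤ 729 ^ d * ((d : ℝ) + 1) ^ 4 := by
  induction d with
  | zero => simp [aFun_zero]
  | succ d ih =>
    have hd : (0 : ℝ) ≤ d := d.cast_nonneg
    set z : ℂ := w + ((d : ℂ) + 1) with hz
    have hzn : (d : ℝ) + 3 / 4 ≤ ‖z‖ := by
      have h1 : ‖(d : ℂ) + 1‖ = (d : ℝ) + 1 := by
        rw [← Nat.cast_succ, Complex.norm_natCast, Nat.cast_succ]
      have h2 : ‖(d : ℂ) + 1‖ - ‖-w‖ ≤ ‖(d : ℂ) + 1 - -w‖ := norm_sub_norm_le _ _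
      rw [norm_neg, sub_neg_eq_add, add_comm _ w, h1, ← hz] at h2
      linarith
    have hz0 : 0 < ‖z‖ := by linarith
    have hfac : ∀ c : ℂ, ‖c‖ ≤ 2 / 3 → ‖z - c‖ * ((d : ℝ) + 1) ≤ ‖z‖ * ((d : ℝ) + 2) := by
      intro c hc
      nlinarith [norm_sub_le z c, norm_nonneg c]
    have h1 := hfac (2 / 3) (by norm_num)
    have h2 := hfac (1 / 3) (by norm_num)
    have hrec := congrArg norm (aFun_succ_mul d (w := w) (norm_pos_iff.mp hz0))
    rw [show w + ((d : ℂ) + 1 / 3) = z - 2 / 3 by rw [hz]; ring,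
      show w + ((d : ℂ) + 2 / 3) = z - 1 / 3 by rw [hz]; ring, ← hz] at hrec
    simp only [norm_mul, norm_pow] at hrec
    rw [show ‖(729 : ℂ)‖ = 729 by norm_num] at hrec
    have hprod : (‖z - 2 / 3‖ ^ 2 * ‖z - 1 / 3‖ ^ 2) * ((d : ℝ) + 1) ^ 4 ≤
        ‖z‖ ^ 4 * ((d : ℝ) + 2) ^ 4 := by
      calc (‖z - 2 / 3‖ ^ 2 * ‖z - 1 / 3‖ ^ 2) * ((d : ℝ) + 1) ^ 4
          = (‖z - 2 / 3‖ * ((d : ℝ) + 1)) ^ 2 * (‖z - 1 / 3‖ * ((d : ℝ) + 1)) ^ 2 := by ring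
        _ ≤ (‖z‖ * ((d : ℝ) + 2)) ^ 2 * (‖z‖ * ((d : ℝ) + 2)) ^ 2 := by gcongr
        _ = ‖z‖ ^ 4 * ((d : ℝ) + 2) ^ 4 := by ring
    refine le_of_mul_le_mul_left ?_ (pow_pos hz0 4)
    rw [hrec]
    calc 729 * ‖z - 2 / 3‖ ^ 2 * ‖z - 1 / 3‖ ^ 2 * ‖aFun d w‖
        ≤ 729 * ‖z - 2 / 3‖ ^ 2 * ‖z - 1 / 3‖ ^ 2 * (729 ^ d * ((d : ℝ) + 1) ^ 4) := by gcongr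
      _ = 729 ^ (d + 1) * ((‖z - 2 / 3‖ ^ 2 * ‖z - 1 / 3‖ ^ 2) * ((d : ℝ) + 1) ^ 4) := by ring
      _ ≤ 729 ^ (d + 1) * (‖z‖ ^ 4 * ((d : ℝ) + 2) ^ 4) := by gcongr
      _ = ‖z‖ ^ 4 * (729 ^ (d + 1) * (((d + 1 : ℕ) : ℝ) + 1) ^ 4) := by push_cast; ring

theorem norm_cCoef_le (d q : ℕ) :
    ‖cCoef d q‖ ≤ 4 ^ q * ((d : ℝ) + 1) ^ 4 * 729 ^ d := by
  have hcl : DiffContOnCl ℂ (aFun d) (Metric.ball 0 (1 / 4)) :=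
    ((differentiableOn_aFun d).mono ((Metric.closure_ball_subset_closedBall).trans
      (Metric.closedBall_subset_ball (by norm_num)))).diffContOnCl
  have h := Complex.norm_iteratedDeriv_le_of_forall_mem_sphere_norm_le q (by norm_num) hcl
    fun w hw => norm_aFun_le d (by simpa using (mem_sphere_zero_iff_norm.mp hw).le)
  rw [cCoef, norm_div, Complex.norm_natCast, div_le_iff₀ (by positivity)]
  refine h.trans (le_of_eq ?_)
  rw [one_div, inv_pow, div_inv_eq_mul]
  ring

/-- The Taylor series of `f` at `0`. -/
noncomputable def taylorAtZero (f : ℂ → ℂ) : PowerSeries ℂ :=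
  PowerSeries.mk fun q => iteratedDeriv q f 0 / (q.factorial : ℂ)

theorem taylorAtZero_mul {f g : ℂ → ℂ} (hf : AnalyticAt ℂ f 0) (hg : AnalyticAt ℂ g 0) :
    taylorAtZero (fun w => f w * g w) = taylorAtZero f * taylorAtZero g := by
  ext q
  rw [PowerSeries.coeff_mul, taylorAtZero, PowerSeries.coeff_mk,
    iteratedDeriv_fun_mul hf.contDiffAt hg.contDiffAt,
    Finset.Nat.sum_antidiagonal_eq_sum_range_succ_mk, Finset.sum_div]
  refine Finset.sum_congr rfl fun k hk => ?_
  have hk' : k ≤ q := Nat.lt_succ_iff.mp (Finset.mem_range.mp hk)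
  simp only [taylorAtZero, PowerSeries.coeff_mk]
  rw [Nat.cast_choose ℂ hk']
  have := Nat.cast_ne_zero (R := ℂ).mpr q.factorial_ne_zero
  field_simp

theorem taylorAtZero_congr {f g : ℂ → ℂ} (h : f =ᶠ[nhds 0] g) :
    taylorAtZero f = taylorAtZero g := by
  ext q
  simp only [taylorAtZero, PowerSeries.coeff_mk, h.iteratedDeriv_eq q]

theorem taylorAtZero_const (c : ℂ) : taylorAtZero (fun _ => c) = PowerSeries.C c := by
  ext q
  simp only [taylorAtZero, PowerSeries.coeff_mk, iteratedDeriv_const, PowerSeries.coeff_C]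
  split_ifs with h <;> simp [h]

theorem taylorAtZero_add_const (c : ℂ) :
    taylorAtZero (fun w => w + c) = PowerSeries.X + PowerSeries.C c := by
  ext q
  simp only [taylorAtZero, PowerSeries.coeff_mk, map_add, PowerSeries.coeff_C, PowerSeries.coeff_X]
  rw [iteratedDeriv_fun_add (by fun_prop) (by fun_prop), iteratedDeriv_fun_id, iteratedDeriv_const]
  rcases q with _ | _ | q <;> simp

theorem taylorAtZero_aFun_zero : taylorAtZero (aFun 0) = 1 := by
  rw [show aFun 0 = fun _ => 1 from funext aFun_zero, taylorAtZero_const, map_one]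

theorem taylorAtZero_aFun_succ (d : ℕ) :
    (PowerSeries.X + PowerSeries.C ((d : ℂ) + 1)) ^ 4 * taylorAtZero (aFun (d + 1)) =
      PowerSeries.C 729 * (PowerSeries.X + PowerSeries.C ((d : ℂ) + 1 / 3)) ^ 2 *
        (PowerSeries.X + PowerSeries.C ((d : ℂ) + 2 / 3)) ^ 2 * taylorAtZero (aFun d) := by
  have h : (fun w => (w + ((d : ℂ) + 1)) * ((w + ((d : ℂ) + 1)) * ((w + ((d : ℂ) + 1)) *
      ((w + ((d : ℂ) + 1)) * aFun (d + 1) w)))) =ᶠ[nhds 0]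
      fun w => 729 * ((w + ((d : ℂ) + 1 / 3)) * ((w + ((d : ℂ) + 1 / 3)) *
        ((w + ((d : ℂ) + 2 / 3)) * ((w + ((d : ℂ) + 2 / 3)) * aFun d w)))) := by
    filter_upwards [Metric.ball_mem_nhds (0 : ℂ) one_pos] with w hw
    have hne := add_natCast_ne_zero_of_norm_lt_one (by simpa using hw) (Nat.succ_pos d)
    push_cast at hne
    linear_combination aFun_succ_mul d hne
  have hd := analyticAt_aFun d
  have hd' := analyticAt_aFun (d + 1)
  have h' := taylorAtZero_congr h
  rw [taylorAtZero_mul (by fun_prop) (by fun_prop), taylorAtZero_mul (by fun_prop) (by fun_prop),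
    taylorAtZero_mul (by fun_prop) (by fun_prop), taylorAtZero_mul (by fun_prop) (by fun_prop),
    taylorAtZero_mul (by fun_prop) (by fun_prop), taylorAtZero_mul (by fun_prop) (by fun_prop),
    taylorAtZero_mul (by fun_prop) (by fun_prop), taylorAtZero_mul (by fun_prop) (by fun_prop),
    taylorAtZero_mul (by fun_prop) (by fun_prop)] at h'
  simp only [taylorAtZero_const, taylorAtZero_add_const] at h'
  linear_combination h'

/-- `u d` is bounded by a polynomial in `d` times `729 ^ d`. -/
def HasGrowth (u : ℕ → ℂ) : Prop :=
  ∃ (K : ℝ) (N : ℕ), 0 ≤ K ∧ ∀ d, ‖u d‖ ≤ K * ((d : ℝ) + 1) ^ N * 729 ^ d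

theorem HasGrowth.add {u v : ℕ → ℂ} (hu : HasGrowth u) (hv : HasGrowth v) :
    HasGrowth fun d => u d + v d := by
  obtain ⟨K, N, hK, hu⟩ := hu
  obtain ⟨L, M, hL, hv⟩ := hv
  refine ⟨K + L, N + M, by positivity, fun d => (norm_add_le _ _).trans ?_⟩
  have h1 : (1 : ℝ) ≤ (d : ℝ) + 1 := by simp
  calc ‖u d‖ + ‖v d‖ ≤ K * ((d : ℝ) + 1) ^ N * 729 ^ d + L * ((d : ℝ) + 1) ^ M * 729 ^ d :=
        add_le_add (hu d) (hv d)
    _ ≤ K * ((d : ℝ) + 1) ^ (N + M) * 729 ^ d + L * ((d : ℝ) + 1) ^ (N + M) * 729 ^ d := by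
        gcongr <;> first | exact h1 | omega
    _ = (K + L) * ((d : ℝ) + 1) ^ (N + M) * 729 ^ d := by ring

theorem HasGrowth.natCast_add_mul {u : ℕ → ℂ} (hu : HasGrowth u) (c : ℂ) :
    HasGrowth fun d => ((d : ℂ) + c) * u d := by
  obtain ⟨K, N, hK, hu⟩ := hu
  refine ⟨(1 + ‖c‖) * K, N + 1, by positivity, fun d => ?_⟩
  have h1 : ‖(d : ℂ) + c‖ ≤ (1 + ‖c‖) * ((d : ℝ) + 1) := by
    refine (norm_add_le _ _).trans ?_
    rw [Complex.norm_natCast]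
    nlinarith [norm_nonneg c, d.cast_nonneg (α := ℝ), mul_nonneg (norm_nonneg c)
      (d.cast_nonneg (α := ℝ))]
  rw [norm_mul]
  calc ‖(d : ℂ) + c‖ * ‖u d‖
      ≤ ((1 + ‖c‖) * ((d : ℝ) + 1)) * (K * ((d : ℝ) + 1) ^ N * 729 ^ d) := by
        gcongr; exact hu d
    _ = (1 + ‖c‖) * K * ((d : ℝ) + 1) ^ (N + 1) * 729 ^ d := by ring

theorem isOpen_Hset : IsOpen Hset := isOpen_lt Complex.continuous_re continuous_const

theorem exp_lt_of_lt {s : ℝ} (hs : s < -6 * Real.log 3) : 729 * Real.exp s < 1 := by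
  have h : Real.exp (-6 * Real.log 3) = 729⁻¹ := by
    rw [show -6 * Real.log 3 = -(Real.log (3 ^ 6)) by rw [Real.log_pow]; push_cast; ring,
      Real.exp_neg, Real.exp_log (by norm_num)]
    norm_num
  have := Real.exp_lt_exp.mpr hs
  rw [h] at this
  linarith

theorem HasGrowth.exists_bound {u : ℕ → ℂ} (hu : HasGrowth u) {s : ℝ}
    (hs : s < -6 * Real.log 3) :
    ∃ b : ℕ → ℝ, Summable b ∧ ∀ d, ∀ t : ℂ, t.re ≤ s → ‖u d * Complex.exp (d * t)‖ ≤ b d := by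
  obtain ⟨K, N, hK, hu⟩ := hu
  have hx0 : 0 < 729 * Real.exp s := by positivity
  have hsum : Summable fun d : ℕ => ((d : ℝ) + 1) ^ N * (729 * Real.exp s) ^ d := by
    have h := (summable_nat_add_iff 1).mpr (summable_pow_mul_geometric_of_norm_lt_one N
      (r := 729 * Real.exp s) (by rw [Real.norm_of_nonneg hx0.le]; exact exp_lt_of_lt hs))
    refine (h.mul_right (729 * Real.exp s)⁻¹).congr fun d => ?_
    push_cast
    field_simp
    ring
  refine ⟨_, hsum.mul_left K, fun d t ht => ?_⟩
  rw [norm_mul, Complex.norm_exp]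
  have h1 : Real.exp ((d * t : ℂ).re) ≤ Real.exp s ^ d := by
    rw [← Real.exp_nat_mul, Real.exp_le_exp]
    simp only [Complex.mul_re, Complex.natCast_re, Complex.natCast_im, zero_mul, sub_zero]
    gcongr
  calc ‖u d‖ * Real.exp ((d * t : ℂ).re)
      ≤ (K * ((d : ℝ) + 1) ^ N * 729 ^ d) * Real.exp s ^ d := by gcongr; exact hu d
    _ = K * (((d : ℝ) + 1) ^ N * (729 * Real.exp s) ^ d) := by rw [mul_pow]; ring

theorem HasGrowth.summable_norm {u : ℕ → ℂ} (hu : HasGrowth u) {t : ℂ} (ht : t ∈ Hset) :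
    Summable fun d : ℕ => ‖u d * Complex.exp (d * t)‖ := by
  obtain ⟨b, hb, hub⟩ := hu.exists_bound ht
  exact hb.of_nonneg_of_le (fun d => norm_nonneg _) fun d => hub d t le_rfl

theorem HasGrowth.summable {u : ℕ → ℂ} (hu : HasGrowth u) {t : ℂ} (ht : t ∈ Hset) :
    Summable fun d : ℕ => u d * Complex.exp (d * t) :=
  (hu.summable_norm ht).of_norm

theorem HasGrowth.hasDerivAt {u : ℕ → ℂ} (hu : HasGrowth u) {t : ℂ} (ht : t ∈ Hset) :
    HasDerivAt (fun t => ∑' d : ℕ, u d * Complex.exp (d * t))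
      (∑' d : ℕ, d * u d * Complex.exp (d * t)) t := by
  obtain ⟨s, hts, hs⟩ := exists_between (show t.re < -6 * Real.log 3 from ht)
  obtain ⟨b, hb, hub⟩ := hu.exists_bound hs
  have hU : IsOpen {t : ℂ | t.re < s} := isOpen_lt Complex.continuous_re continuous_const
  have hF : ∀ d : ℕ, DifferentiableOn ℂ (fun t => u d * Complex.exp (d * t)) {t : ℂ | t.re < s} :=
    fun d => by fun_prop
  have hle : ∀ d : ℕ, ∀ t ∈ {t : ℂ | t.re < s}, ‖u d * Complex.exp (d * t)‖ ≤ b d :=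
    fun d t h => hub d t (le_of_lt h)
  have hsum := Complex.hasSum_deriv_of_summable_norm hb hF hU hle hts
  have hdiff := (Complex.differentiableOn_tsum_of_summable_norm hb hF hU hle).differentiableAt
    (hU.mem_nhds hts)
  refine hdiff.hasDerivAt.congr_deriv ?_
  rw [← hsum.tsum_eq]
  refine tsum_congr fun d => ?_
  have : HasDerivAt (fun t : ℂ => u d * Complex.exp (d * t))
      (u d * (Complex.exp (d * t) * (d * 1))) t :=
    (((hasDerivAt_id t).const_mul (d : ℂ)).cexp).const_mul (u d)
  rw [this.deriv]
  ring

/-- The `q`-th coefficient in `w` of `∑ d, A d * exp ((w + d) * t)`, where `A d` is a power series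
in `w`. -/
noncomputable def expSeriesCoeff (A : ℕ → PowerSeries ℂ) (q : ℕ) (t : ℂ) : ℂ :=
  ∑ k ∈ Finset.range (q + 1), t ^ k / (k.factorial : ℂ) *
    ∑' d : ℕ, PowerSeries.coeff (q - k) (A d) * Complex.exp (d * t)

/-- The action of `D + c` on the coefficients `A d` of `∑ d, A d * exp ((w + d) * t)`. -/
noncomputable def shiftMul (c : ℂ) (A : ℕ → PowerSeries ℂ) (d : ℕ) : PowerSeries ℂ :=
  (PowerSeries.X + PowerSeries.C ((d : ℂ) + c)) * A d

theorem coeff_zero_shiftMul (c : ℂ) (A : ℕ → PowerSeries ℂ) (d : ℕ) :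
    PowerSeries.coeff 0 (shiftMul c A d) = ((d : ℂ) + c) * PowerSeries.coeff 0 (A d) := by
  simp [shiftMul]

theorem coeff_succ_shiftMul (c : ℂ) (A : ℕ → PowerSeries ℂ) (d q : ℕ) :
    PowerSeries.coeff (q + 1) (shiftMul c A d) =
      ((d : ℂ) + c) * PowerSeries.coeff (q + 1) (A d) + PowerSeries.coeff q (A d) := by
  rw [shiftMul, add_mul, map_add, PowerSeries.coeff_succ_X_mul, PowerSeries.coeff_C_mul, add_comm]

/-- Every coefficient of `A d` has growth at most polynomial times `729 ^ d`. -/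
def CoeffGrowth (A : ℕ → PowerSeries ℂ) : Prop :=
  ∀ q, HasGrowth fun d => PowerSeries.coeff q (A d)

theorem CoeffGrowth.shiftMul {A : ℕ → PowerSeries ℂ} (hA : CoeffGrowth A) (c : ℂ) :
    CoeffGrowth (shiftMul c A) := by
  rintro (_ | q)
  · simpa only [coeff_zero_shiftMul] using (hA 0).natCast_add_mul c
  · simpa only [coeff_succ_shiftMul] using ((hA (q + 1)).natCast_add_mul c).add (hA q)

theorem CoeffGrowth.tsum_coeff_zero_shiftMul {A : ℕ → PowerSeries ℂ} (hA : CoeffGrowth A) (c : ℂ)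
    {t : ℂ} (ht : t ∈ Hset) :
    ∑' d : ℕ, PowerSeries.coeff 0 (_root_.shiftMul c A d) * Complex.exp (d * t) =
      (∑' d : ℕ, d * PowerSeries.coeff 0 (A d) * Complex.exp (d * t)) +
        c * ∑' d : ℕ, PowerSeries.coeff 0 (A d) * Complex.exp (d * t) := by
  have h1 := by simpa only [add_zero] using ((hA 0).natCast_add_mul 0).summable ht
  have h2 := ((hA 0).summable ht).mul_left c
  rw [← tsum_mul_left, ← h1.tsum_add h2]
  refine tsum_congr fun d => ?_
  rw [coeff_zero_shiftMul]
  ring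

theorem CoeffGrowth.tsum_coeff_succ_shiftMul {A : ℕ → PowerSeries ℂ} (hA : CoeffGrowth A) (c : ℂ)
    (q : ℕ) {t : ℂ} (ht : t ∈ Hset) :
    ∑' d : ℕ, PowerSeries.coeff (q + 1) (_root_.shiftMul c A d) * Complex.exp (d * t) =
      ((∑' d : ℕ, d * PowerSeries.coeff (q + 1) (A d) * Complex.exp (d * t)) +
        c * ∑' d : ℕ, PowerSeries.coeff (q + 1) (A d) * Complex.exp (d * t)) +
        ∑' d : ℕ, PowerSeries.coeff q (A d) * Complex.exp (d * t) := by
  have h1 := by simpa only [add_zero] using ((hA (q + 1)).natCast_add_mul 0).summable ht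
  have h2 := ((hA (q + 1)).summable ht).mul_left c
  rw [← tsum_mul_left, ← h1.tsum_add h2, ← (h1.add h2).tsum_add ((hA q).summable ht)]
  refine tsum_congr fun d => ?_
  rw [coeff_succ_shiftMul]
  ring

theorem hasDerivAt_pow_div_factorial (k : ℕ) (t : ℂ) :
    HasDerivAt (fun t : ℂ => t ^ (k + 1) / ((k + 1).factorial : ℂ)) (t ^ k / (k.factorial : ℂ)) t := by
  refine ((hasDerivAt_pow (k + 1) t).div_const ((k + 1).factorial : ℂ)).congr_deriv ?_
  have h1 := Nat.cast_ne_zero (R := ℂ).mpr k.factorial_ne_zero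
  have h2 : (k : ℂ) + 1 ≠ 0 := by exact_mod_cast k.succ_ne_zero
  rw [Nat.factorial_succ]
  push_cast
  field_simp

theorem CoeffGrowth.hasDerivAt {A : ℕ → PowerSeries ℂ} (hA : CoeffGrowth A) (c : ℂ) (q : ℕ)
    {t : ℂ} (ht : t ∈ Hset) :
    HasDerivAt (expSeriesCoeff A q)
      (expSeriesCoeff (_root_.shiftMul c A) q t - c * expSeriesCoeff A q t) t := by
  have hlead : HasDerivAt (fun t : ℂ => ∑ k ∈ Finset.range q,
      t ^ (k + 1) / ((k + 1).factorial : ℂ) *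
        ∑' d : ℕ, PowerSeries.coeff (q - (k + 1)) (A d) * Complex.exp (d * t)) _ t :=
    HasDerivAt.fun_sum fun k _ =>
      (hasDerivAt_pow_div_factorial k t).mul ((hA (q - (k + 1))).hasDerivAt ht)
  have hzero : HasDerivAt (fun t : ℂ => t ^ 0 / ((Nat.factorial 0 : ℕ) : ℂ) *
      ∑' d : ℕ, PowerSeries.coeff (q - 0) (A d) * Complex.exp (d * t))
      (∑' d : ℕ, d * PowerSeries.coeff (q - 0) (A d) * Complex.exp (d * t)) t := by
    simpa using (hA q).hasDerivAt ht
  have heq : expSeriesCoeff A q = fun t : ℂ => (∑ k ∈ Finset.range q,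
      t ^ (k + 1) / ((k + 1).factorial : ℂ) *
        ∑' d : ℕ, PowerSeries.coeff (q - (k + 1)) (A d) * Complex.exp (d * t)) +
      t ^ 0 / ((Nat.factorial 0 : ℕ) : ℂ) *
        ∑' d : ℕ, PowerSeries.coeff (q - 0) (A d) * Complex.exp (d * t) :=
    funext fun t => Finset.sum_range_succ' _ q
  refine (heq ▸ hlead.fun_add hzero).congr_deriv ?_
  have hS : expSeriesCoeff (_root_.shiftMul c A) q t =
      (∑ k ∈ Finset.range (q + 1), t ^ k / (k.factorial : ℂ) *
        ((∑' d : ℕ, d * PowerSeries.coeff (q - k) (A d) * Complex.exp (d * t)) +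
          c * ∑' d : ℕ, PowerSeries.coeff (q - k) (A d) * Complex.exp (d * t))) +
      ∑ k ∈ Finset.range q, t ^ k / (k.factorial : ℂ) *
        ∑' d : ℕ, PowerSeries.coeff (q - (k + 1)) (A d) * Complex.exp (d * t) := by
    unfold expSeriesCoeff
    rw [Finset.sum_range_succ, Finset.sum_range_succ _ q, add_right_comm,
      ← Finset.sum_add_distrib]
    congr 1
    · refine Finset.sum_congr rfl fun k hk => ?_
      have hk' := Finset.mem_range.mp hk
      rw [show q - k = q - (k + 1) + 1 by omega, hA.tsum_coeff_succ_shiftMul c _ ht]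
      ring
    · rw [Nat.sub_self, hA.tsum_coeff_zero_shiftMul c ht]
  rw [hS]
  have hc : c * expSeriesCoeff A q t = ∑ k ∈ Finset.range (q + 1), t ^ k / (k.factorial : ℂ) *
      (c * ∑' d : ℕ, PowerSeries.coeff (q - k) (A d) * Complex.exp (d * t)) := by
    rw [expSeriesCoeff, Finset.mul_sum]
    exact Finset.sum_congr rfl fun k _ => by ring
  rw [hc]
  simp only [mul_add, Finset.sum_add_distrib]
  rw [Finset.sum_range_succ' (fun k => t ^ k / (k.factorial : ℂ) *
    ∑' d : ℕ, d * PowerSeries.coeff (q - k) (A d) * Complex.exp (d * t))]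
  simp only [pow_zero, Nat.factorial_zero, Nat.cast_one, div_one, one_mul]
  ring

theorem CoeffGrowth.eqOn_DOp {A : ℕ → PowerSeries ℂ} (hA : CoeffGrowth A) (c : ℂ) {q : ℕ}
    {f : ℂ → ℂ} (hf : Set.EqOn f (expSeriesCoeff A q) Hset) :
    Set.EqOn (DOp c f) (expSeriesCoeff (_root_.shiftMul c A) q) Hset := by
  intro t ht
  have h := (hA.hasDerivAt c q ht).congr_of_eventuallyEq
    (hf.eventuallyEq_of_mem (isOpen_Hset.mem_nhds ht))
  rw [DOp, h.deriv, hf ht]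
  ring

theorem CoeffGrowth.eqOn_deriv {A : ℕ → PowerSeries ℂ} (hA : CoeffGrowth A) {q : ℕ}
    {f : ℂ → ℂ} (hf : Set.EqOn f (expSeriesCoeff A q) Hset) :
    Set.EqOn (deriv f) (expSeriesCoeff (_root_.shiftMul 0 A) q) Hset := by
  intro t ht
  rw [← hA.eqOn_DOp 0 hf ht, DOp, zero_mul, add_zero]

theorem coeff_taylorAtZero_aFun (d q : ℕ) :
    PowerSeries.coeff q (taylorAtZero (aFun d)) = cCoef d q := by
  rw [taylorAtZero, PowerSeries.coeff_mk, cCoef]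

theorem coeffGrowth_taylorAtZero_aFun : CoeffGrowth fun d => taylorAtZero (aFun d) := by
  intro q
  refine ⟨4 ^ q, 4, by positivity, fun d => ?_⟩
  simpa only [coeff_taylorAtZero_aFun] using norm_cCoef_le d q

theorem I0_eq_expSeriesCoeff (q : ℕ) :
    I0 q = expSeriesCoeff (fun d => taylorAtZero (aFun d)) q := by
  funext t
  simp only [I0, Ihat, expSeriesCoeff, coeff_taylorAtZero_aFun]

/-- If `B` vanishes to order `> q` at `d = 0` and `B (d + 1) = b * B' d`, then the function with
coefficients `B` is `b * exp t` times the one with coefficients `B'`. -/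
theorem expSeriesCoeff_eq_mul_exp {B B' : ℕ → PowerSeries ℂ} (hB : CoeffGrowth B) {b : ℂ} {q : ℕ}
    (h0 : ∀ j ≤ q, PowerSeries.coeff j (B 0) = 0)
    (hsucc : ∀ d, B (d + 1) = PowerSeries.C b * B' d) {t : ℂ} (ht : t ∈ Hset) :
    expSeriesCoeff B q t = b * Complex.exp t * expSeriesCoeff B' q t := by
  rw [expSeriesCoeff, expSeriesCoeff, Finset.mul_sum]
  refine Finset.sum_congr rfl fun k _ => ?_
  rw [Summable.tsum_eq_zero_add ((hB (q - k)).summable ht), h0 _ (Nat.sub_le q k), zero_mul, zero_add,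
    mul_left_comm, ← tsum_mul_left (a := b * Complex.exp t)]
  congr 1
  refine tsum_congr fun d => ?_
  rw [hsucc, PowerSeries.coeff_C_mul, Nat.cast_succ, add_mul, one_mul, Complex.exp_add]
  ring

theorem picardFuchs_I0 {q : ℕ} (hq : q ≤ 3) {t : ℂ} (ht : t ∈ Hset) :
    deriv (deriv (deriv (deriv (I0 q)))) t -
      729 * Complex.exp t *
        (DOp (1 / 3) (DOp (1 / 3) (DOp (2 / 3) (DOp (2 / 3) (I0 q))))) t = 0 := by
  have hA := coeffGrowth_taylorAtZero_aFun
  have hf : Set.EqOn (I0 q) (expSeriesCoeff (fun d => taylorAtZero (aFun d)) q) Hset :=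
    fun t _ => congrFun (I0_eq_expSeriesCoeff q) t
  have hB := (((hA.shiftMul 0).shiftMul 0).shiftMul 0).shiftMul 0
  rw [((hA.shiftMul 0).shiftMul 0).shiftMul 0 |>.eqOn_deriv (((hA.shiftMul 0).shiftMul 0).eqOn_deriv
      ((hA.shiftMul 0).eqOn_deriv (hA.eqOn_deriv hf))) ht,
    ((hA.shiftMul (2 / 3)).shiftMul (2 / 3)).shiftMul (1 / 3) |>.eqOn_DOp (1 / 3)
      (((hA.shiftMul (2 / 3)).shiftMul (2 / 3)).eqOn_DOp (1 / 3)
      ((hA.shiftMul (2 / 3)).eqOn_DOp (2 / 3) (hA.eqOn_DOp (2 / 3) hf))) ht, sub_eq_zero]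
  refine expSeriesCoeff_eq_mul_exp hB (fun j hj => ?_) (fun d => ?_) ht
  · have h : shiftMul 0 (shiftMul 0 (shiftMul 0 (shiftMul 0 fun d => taylorAtZero (aFun d)))) 0 =
        PowerSeries.X ^ 4 := by
      simp only [shiftMul, taylorAtZero_aFun_zero, Nat.cast_zero, add_zero, map_zero]
      ring
    rw [h, PowerSeries.coeff_X_pow, if_neg (by omega)]
  · simp only [shiftMul, Nat.cast_succ, add_zero]
    linear_combination taylorAtZero_aFun_succ d

theorem Ihat_add_two_pi_mul_I (q n : ℕ) (t : ℂ) :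
    Ihat q (t + n * (2 * Real.pi * Complex.I)) = Ihat q t := by
  refine tsum_congr fun d => ?_
  rw [show (d : ℂ) * (t + n * (2 * Real.pi * Complex.I)) =
    d * t + ((d * n : ℕ) : ℂ) * (2 * Real.pi * Complex.I) by push_cast; ring, Complex.exp_add,
    Complex.exp_nat_mul_two_pi_mul_I, mul_one]

theorem add_two_pi_mul_I_mem_Hset {t : ℂ} (ht : t ∈ Hset) (n : ℕ) :
    t + n * (2 * Real.pi * Complex.I) ∈ Hset := by
  simpa [Hset] using ht

theorem aFun_apply_zero (d : ℕ) : ∃ x : ℝ, 0 ≤ x ∧ aFun d 0 = x := by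
  refine ⟨(∏ r ∈ Finset.Icc 1 (3 * d), (r : ℝ) ^ 2) / (∏ r ∈ Finset.Icc 1 d, (r : ℝ) ^ 6),
    by positivity, ?_⟩
  simp [aFun]

theorem Ihat_zero_ofReal_ne_zero {x : ℝ} (hx : (x : ℂ) ∈ Hset) : Ihat 0 x ≠ 0 := by
  have hA := (coeffGrowth_taylorAtZero_aFun 0).summable hx
  choose y hy0 hy using aFun_apply_zero
  have hterm : ∀ d : ℕ, PowerSeries.coeff 0 (taylorAtZero (aFun d)) * Complex.exp (d * x) =
      ((y d * Real.exp (d * x) : ℝ) : ℂ) := by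
    intro d
    simp [taylorAtZero, hy]
  have hI : Ihat 0 x = ((∑' d : ℕ, y d * Real.exp (d * x) : ℝ) : ℂ) := by
    rw [Complex.ofReal_tsum]
    refine tsum_congr fun d => ?_
    rw [← hterm, coeff_taylorAtZero_aFun]
  simp only [hterm] at hA
  have hs := Complex.summable_ofReal.mp hA
  have hy1 : y 0 = 1 := by
    have := hy 0
    rw [aFun_zero] at this
    exact_mod_cast this.symm
  have hpos : 0 < ∑' d : ℕ, y d * Real.exp (d * x) :=
    hs.tsum_pos (fun d => mul_nonneg (hy0 d) (Real.exp_pos _).le) 0 (by simp [hy1])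
  rw [hI]
  exact_mod_cast hpos.ne'

theorem linearIndependent_I0 (a b c e : ℂ)
    (h : ∀ t ∈ Hset, a * I0 0 t + b * I0 1 t + c * I0 2 t + e * I0 3 t = 0) :
    a = 0 ∧ b = 0 ∧ c = 0 ∧ e = 0 := by
  obtain ⟨x, hx⟩ := exists_lt (-6 * Real.log 3)
  have ht : (x : ℂ) ∈ Hset := by simpa [Hset] using hx
  have h0 := Ihat_zero_ofReal_ne_zero ht
  have hp : (2 * Real.pi * Complex.I : ℂ) ≠ 0 := Complex.two_pi_I_ne_zero
  have H : ∀ n : ℕ, _ := fun n => h _ (add_two_pi_mul_I_mem_Hset ht n)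
  simp only [I0, Finset.sum_range_succ, Finset.sum_range_zero, Ihat_add_two_pi_mul_I, zero_add,
    Nat.sub_self, Nat.sub_zero, Nat.reduceSub, Nat.reduceAdd, Nat.factorial] at H
  have H0 := H 0
  have H1 := H 1
  have H2 := H 2
  have H3 := H 3
  generalize (2 * Real.pi * Complex.I : ℂ) = p at *
  push_cast at H0 H1 H2 H3
  have he : e = 0 := by
    have : e * (Ihat 0 x * p ^ 3) = 0 := by linear_combination H3 - 3 * H2 + 3 * H1 - H0
    simpa [h0, hp] using this
  subst he
  have hc : c = 0 := by
    have : c * (Ihat 0 x * p ^ 2) = 0 := by linear_combination H2 - 2 * H1 + H0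
    simpa [h0, hp] using this
  subst hc
  have hb : b = 0 := by
    have : b * (Ihat 0 x * p) = 0 := by linear_combination H1 - H0
    simpa [h0, hp] using this
  subst hb
  have ha : a = 0 := by
    have : a * Ihat 0 x = 0 := by linear_combination H0
    simpa [h0] using this
  exact ⟨ha, rfl, rfl, rfl⟩

/-- For `0 ≤ q ≤ 3`: the series `Î_q` converges absolutely on `H` and is holomorphic there;
each `I_{0,q}` satisfies the Picard–Fuchs equation
`D⁴f − 729·e^t·(D+1/3)²(D+2/3)²f = 0` on `H`; and `I_{0,0}, I_{0,1}, I_{0,2}, I_{0,3}` are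
linearly independent over `ℂ`. -/
theorem I0q_solutions_linearly_independent :
    (∀ q ≤ 3, (∀ t ∈ Hset, Summable fun d : ℕ => ‖cCoef d q * Complex.exp (d * t)‖) ∧
      DifferentiableOn ℂ (Ihat q) Hset) ∧
    (∀ q ≤ 3, ∀ t ∈ Hset,
      deriv (deriv (deriv (deriv (I0 q)))) t -
          729 * Complex.exp t *
            (DOp (1 / 3) (DOp (1 / 3) (DOp (2 / 3) (DOp (2 / 3) (I0 q))))) t = 0) ∧
    (∀ a b c e : ℂ,
      (∀ t ∈ Hset, a * I0 0 t + b * I0 1 t + c * I0 2 t + e * I0 3 t = 0) →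
      a = 0 ∧ b = 0 ∧ c = 0 ∧ e = 0) := by
  refine ⟨fun q _ => ⟨fun t ht => ?_, fun t ht => ?_⟩, fun q hq t ht => picardFuchs_I0 hq ht,
    linearIndependent_I0⟩
  · have h := (coeffGrowth_taylorAtZero_aFun q).summable_norm ht
    simpa only [coeff_taylorAtZero_aFun] using h
  · have h := (coeffGrowth_taylorAtZero_aFun q).hasDerivAt ht
    simp only [coeff_taylorAtZero_aFun] at h
    exact h.differentiableAt.differentiableWithinAt
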